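/- arXiv:1305.5092 — 2 statements merged into one kernel-verified Lean document; each statement's English description precedes it below -/
import Mathlib

section
/- Let M be one of the two Latin squares M_1, M_2 of order 4. Any two (3,4)-nets in P^2(C) all of whose multiple points have multiplicity 2 or 3, both of which are encoded by M and which have equal numbers of triple points, are lattice isomorphic. -/
open scoped Classical

noncomputable section

/-- The complex projective plane `P²(ℂ)`. -/
abbrev ProjPlane : Type := Projectivization ℂ (Fin 3 → ℂ)

/-- A subset of `P²(ℂ)` is a projective line if it is the zero locus of a nonzero
linear form. -/
def IsProjLine (S : Set ProjPlane) : Prop :=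
  ∃ f : (Fin 3 → ℂ) →ₗ[ℂ] ℂ, f ≠ 0 ∧ S = {p : ProjPlane | f p.rep = 0}

/-- The lines of the arrangement `A` passing through the point `p`. -/
def linesThrough (A : Finset (Set ProjPlane)) (p : ProjPlane) : Finset (Set ProjPlane) :=
  A.filter fun L => p ∈ L

/-- The multiplicity of a point `p` with respect to the arrangement `A`. -/
def mult (A : Finset (Set ProjPlane)) (p : ProjPlane) : ℕ :=
  (linesThrough A p).card

/-- `p` is a multiple point of the arrangement `A` (at least two lines pass through it). -/
def IsMultPoint (A : Finset (Set ProjPlane)) (p : ProjPlane) : Prop :=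
  2 ≤ mult A p

/-- A `q`-cocycle of the line arrangement `A`: for every multiple point `p`,
if `q` divides the multiplicity then the values of `η` on the lines through `p` sum to `0`,
and otherwise `η` is constant on the lines through `p`. -/
def IsCocycle (q : ℕ) (A : Finset (Set ProjPlane)) (η : Set ProjPlane → ZMod q) : Prop :=
  ∀ p : ProjPlane, IsMultPoint A p →
    ((q ∣ mult A p → ∑ L ∈ linesThrough A p, η L = 0) ∧
     (¬ q ∣ mult A p → ∀ L ∈ linesThrough A p, ∀ K ∈ linesThrough A p, η L = η K))

/-- A function on lines is non-constant on the arrangement `A`. -/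
def NonConstant {α : Type*} (A : Finset (Set ProjPlane)) (η : Set ProjPlane → α) : Prop :=
  ∃ L ∈ A, ∃ K ∈ A, η L ≠ η K

/-- A `(k,q)`-net structure on the line arrangement `A`, with classes `C 0, …, C (k-1)`:
the classes partition `A` into `k` classes of `q` lines each, and whenever two lines from
different classes meet, their intersection point lies on exactly one line of each class. -/
def IsNet (k q : ℕ) (A : Finset (Set ProjPlane)) (C : Fin k → Finset (Set ProjPlane)) : Prop :=
  (∀ L ∈ A, IsProjLine L) ∧
  A.card = k * q ∧
  (∀ i, (C i).card = q) ∧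
  (∀ i j, i ≠ j → Disjoint (C i) (C j)) ∧
  (∀ i, C i ⊆ A) ∧
  (∀ L ∈ A, ∃ i, L ∈ C i) ∧
  (∀ i j, i ≠ j → ∀ L ∈ C i, ∀ K ∈ C j, ∀ p : ProjPlane, p ∈ L → p ∈ K →
    ∀ m : Fin k, ∃! N, N ∈ C m ∧ p ∈ N)

/-- Lattice isomorphism of two line arrangements: a bijection between the lines such that
a subfamily of lines has a common point iff the image subfamily has a common point. -/
def LatticeIso (A B : Finset (Set ProjPlane)) : Prop :=
  ∃ φ : Set ProjPlane → Set ProjPlane, Set.BijOn φ ↑A ↑B ∧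
    ∀ S : Finset (Set ProjPlane), S ⊆ A →
      ((∃ p : ProjPlane, ∀ L ∈ S, p ∈ L) ↔ ∃ p : ProjPlane, ∀ L ∈ S, p ∈ φ L)

/-- The projective line with homogeneous equation `a·x + b·y + c·z = 0`. -/
def lineOf (a b c : ℂ) : Set ProjPlane :=
  {p : ProjPlane | a * p.rep 0 + b * p.rep 1 + c * p.rep 2 = 0}

/-- The cyclic Latin square of order 4 (rows (1,2,3,4), (2,3,4,1), (3,4,1,2), (4,1,2,3),
written with symbols `0,1,2,3` instead of `1,2,3,4`). -/
def M1 : Fin 4 → Fin 4 → Fin 4 :=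
  ![![0, 1, 2, 3], ![1, 2, 3, 0], ![2, 3, 0, 1], ![3, 0, 1, 2]]

/-- The Klein Latin square of order 4 (rows (1,2,3,4), (2,1,4,3), (3,4,1,2), (4,3,2,1),
written with symbols `0,1,2,3` instead of `1,2,3,4`). -/
def M2 : Fin 4 → Fin 4 → Fin 4 :=
  ![![0, 1, 2, 3], ![1, 0, 3, 2], ![2, 3, 0, 1], ![3, 2, 1, 0]]

/-- A (3,4)-net with classes `C` is encoded by the Latin square `M` if there are labelings
of the lines of the classes so that `L¹ₖ, L²ₗ, L³_{M(k,l)}` are always concurrent. -/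
def EncodedBy (C : Fin 3 → Finset (Set ProjPlane)) (M : Fin 4 → Fin 4 → Fin 4) : Prop :=
  ∃ L : Fin 3 → Fin 4 → Set ProjPlane,
    (∀ j, C j = Finset.image (L j) Finset.univ) ∧
    ∀ k l : Fin 4, ∃ p : ProjPlane, p ∈ L 0 k ∧ p ∈ L 1 l ∧ p ∈ L 2 (M k l)

/-- The determinant of the matrix with rows `u`, `v`, `w`. -/
def tripleDet (u v w : Fin 3 → ℂ) : ℂ := (Matrix.of ![u, v, w]).det

lemma tripleDet_eq (u v w : Fin 3 → ℂ) : tripleDet u v w =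
    u 0 * (v 1 * w 2 - v 2 * w 1) - u 1 * (v 0 * w 2 - v 2 * w 0)
      + u 2 * (v 0 * w 1 - v 1 * w 0) := by
  simp [tripleDet, Matrix.det_fin_three]
  ring

lemma tripleDet_vecMul (E : Matrix (Fin 3) (Fin 3) ℂ) (u v w : Fin 3 → ℂ) :
    tripleDet (Matrix.vecMul u E) (Matrix.vecMul v E) (Matrix.vecMul w E) =
      tripleDet u v w * E.det := by
  rw [tripleDet, tripleDet, ← Matrix.det_mul]
  congr 1
  ext i j
  fin_cases i <;> simp [Matrix.mul_apply, Matrix.vecMul, dotProduct]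

/-- Pappus' theorem in coordinates adapted to the frame `a₁, a₂, b₁`. -/
lemma pappus_of_frame {a₁ a₂ a₃ b₁ b₂ b₃ c₁ c₂ c₃ : Fin 3 → ℂ}
    (ha₁ : a₁ = ![1, 0, 0]) (ha₂ : a₂ = ![0, 1, 0]) (hb₁ : b₁ = ![0, 0, 1])
    (ha : tripleDet a₁ a₂ a₃ = 0) (hb : tripleDet b₁ b₂ b₃ = 0)
    (h₁₂ : tripleDet a₁ b₂ c₃ = 0) (h₂₁ : tripleDet a₂ b₁ c₃ = 0)
    (h₁₃ : tripleDet a₁ b₃ c₂ = 0) (h₃₁ : tripleDet a₃ b₁ c₂ = 0)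
    (h₂₃ : tripleDet a₂ b₃ c₁ = 0) (h₃₂ : tripleDet a₃ b₂ c₁ = 0)
    (n₁ : tripleDet a₁ b₁ b₂ ≠ 0) (n₂ : tripleDet a₂ a₃ b₁ ≠ 0)
    (n₃ : tripleDet a₁ b₁ b₃ ≠ 0) :
    tripleDet c₁ c₂ c₃ = 0 := by
  subst ha₁ ha₂ hb₁
  simp only [tripleDet_eq, Matrix.cons_val] at *
  ring_nf at ha hb h₁₂ h₂₁ h₁₃ h₃₁ h₂₃ n₁ n₂ n₃
  rw [neg_ne_zero] at n₁ n₂ n₃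
  refine (mul_eq_zero.1 ?_).resolve_left (mul_ne_zero (mul_ne_zero n₁ n₂) n₃)
  simp only [ha, h₂₁] at *
  linear_combination a₃ 0 * b₃ 1 * (c₁ 0 * c₂ 1 - c₁ 1 * c₂ 0) * h₁₂
    + (c₃ 1 * b₂ 1 * c₁ 0 * b₃ 2 - c₁ 0 * b₂ 2 * b₃ 1 * c₃ 1) * h₃₁
    + c₃ 1 * b₃ 1 * c₂ 0 * h₃₂ - c₃ 1 * a₃ 0 * b₂ 1 * c₁ 0 * h₁₃
    + c₃ 1 * a₃ 1 * c₂ 0 * c₁ 2 * hb - c₃ 1 * a₃ 1 * c₂ 0 * b₂ 1 * h₂₃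

/-- **Pappus' theorem** in vector form. -/
lemma pappus {a₁ a₂ a₃ b₁ b₂ b₃ c₁ c₂ c₃ : Fin 3 → ℂ}
    (ha : tripleDet a₁ a₂ a₃ = 0) (hb : tripleDet b₁ b₂ b₃ = 0)
    (h₁₂ : tripleDet a₁ b₂ c₃ = 0) (h₂₁ : tripleDet a₂ b₁ c₃ = 0)
    (h₁₃ : tripleDet a₁ b₃ c₂ = 0) (h₃₁ : tripleDet a₃ b₁ c₂ = 0)
    (h₂₃ : tripleDet a₂ b₃ c₁ = 0) (h₃₂ : tripleDet a₃ b₂ c₁ = 0)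
    (n₀ : tripleDet a₁ a₂ b₁ ≠ 0)
    (n₁ : tripleDet a₁ b₁ b₂ ≠ 0) (n₂ : tripleDet a₂ a₃ b₁ ≠ 0)
    (n₃ : tripleDet a₁ b₁ b₃ ≠ 0) :
    tripleDet c₁ c₂ c₃ = 0 := by
  set E : Matrix (Fin 3) (Fin 3) ℂ := Matrix.of ![a₁, a₂, b₁] with hE
  have hdet : E.det ≠ 0 := n₀
  have hcoord : ∀ u : Fin 3 → ℂ, ∃ w, Matrix.vecMul w E = u := fun u =>
    ⟨Matrix.vecMul u E⁻¹, by
      rw [Matrix.vecMul_vecMul, Matrix.nonsing_inv_mul _ hdet.isUnit, Matrix.vecMul_one]⟩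
  have e₁ : Matrix.vecMul ![1, 0, 0] E = a₁ := by
    ext j; simp [Matrix.vecMul, dotProduct, Fin.sum_univ_three, hE]
  have e₂ : Matrix.vecMul ![0, 1, 0] E = a₂ := by
    ext j; simp [Matrix.vecMul, dotProduct, Fin.sum_univ_three, hE]
  have e₃ : Matrix.vecMul ![0, 0, 1] E = b₁ := by
    ext j; simp [Matrix.vecMul, dotProduct, Fin.sum_univ_three, hE]
  clear_value E
  obtain ⟨a₃, rfl⟩ := hcoord a₃
  obtain ⟨b₂, rfl⟩ := hcoord b₂
  obtain ⟨b₃, rfl⟩ := hcoord b₃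
  obtain ⟨c₁, rfl⟩ := hcoord c₁
  obtain ⟨c₂, rfl⟩ := hcoord c₂
  obtain ⟨c₃, rfl⟩ := hcoord c₃
  subst e₁ e₂ e₃
  simp only [tripleDet_vecMul, mul_eq_zero, hdet, or_false, ne_eq] at *
  exact pappus_of_frame rfl rfl rfl ha hb h₁₂ h₂₁ h₁₃ h₃₁ h₂₃ h₃₂ n₁ n₂ n₃

lemma IsProjLine.exists_vec {S : Set ProjPlane} (h : IsProjLine S) :
    ∃ v : Fin 3 → ℂ, v ≠ 0 ∧ ∀ p : ProjPlane, p ∈ S ↔ v ⬝ᵥ p.rep = 0 := by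
  obtain ⟨f, hf, rfl⟩ := h
  have key : ∀ w, f w = (fun i => f (Pi.single i 1)) ⬝ᵥ w := fun w => by
    conv_lhs => rw [pi_eq_sum_univ' w]
    simp [dotProduct, mul_comm]
  refine ⟨fun i => f (Pi.single i 1), fun h0 => hf ?_, fun p => ?_⟩
  · ext w
    have := congrFun h0 w
    simpa using this
  · rw [← key]; rfl

/-- Two distinct lines of the projective plane have at most one common point. -/
lemma IsProjLine.inter_unique {S T : Set ProjPlane} (hS : IsProjLine S) (hT : IsProjLine T)
    (hST : S ≠ T) {p q : ProjPlane} (hpS : p ∈ S) (hqS : q ∈ S) (hpT : p ∈ T) (hqT : q ∈ T) :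
    p = q := by
  obtain ⟨v, hv, hvS⟩ := hS.exists_vec
  obtain ⟨w, hw, hwT⟩ := hT.exists_vec
  have orth : ∀ (u : Fin 3 → ℂ) (hu : u ≠ 0) (r : ProjPlane),
      r.orthogonal (Projectivization.mk ℂ u hu) ↔ u ⬝ᵥ r.rep = 0 := fun u hu r => by
    conv_lhs => rw [← r.mk_rep]
    rw [Projectivization.orthogonal_mk r.rep_nonzero hu, dotProduct_comm]
  refine (Configuration.ofField.eq_or_eq_of_orthogonal ((orth v hv p).2 ((hvS p).1 hpS))
    ((orth v hv q).2 ((hvS q).1 hqS)) ((orth w hw p).2 ((hwT p).1 hpT))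
    ((orth w hw q).2 ((hwT q).1 hqT))).resolve_right fun h => hST ?_
  ext r
  rw [hvS, hwT, ← orth v hv, ← orth w hw, h]

lemma exists_point_iff_tripleDet (u v w : Fin 3 → ℂ) :
    (∃ p : ProjPlane, u ⬝ᵥ p.rep = 0 ∧ v ⬝ᵥ p.rep = 0 ∧ w ⬝ᵥ p.rep = 0) ↔
      tripleDet u v w = 0 := by
  rw [tripleDet, ← Matrix.exists_mulVec_eq_zero_iff]
  have key : ∀ x, (Matrix.of ![u, v, w]).mulVec x = 0 ↔ u ⬝ᵥ x = 0 ∧ v ⬝ᵥ x = 0 ∧ w ⬝ᵥ x = 0 := by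
    intro x
    simp [funext_iff, Fin.forall_fin_succ]
  constructor
  · rintro ⟨p, hp⟩
    exact ⟨p.rep, p.rep_nonzero, (key _).2 hp⟩
  · rintro ⟨x, hx, h⟩
    obtain ⟨a, ha⟩ := Projectivization.exists_smul_eq_mk_rep ℂ x hx
    refine ⟨Projectivization.mk ℂ x hx, ?_⟩
    rw [← ha, ← key, Units.smul_def, Matrix.mulVec_smul, h, smul_zero]

/-- The lines with labels in `T` have a common point. -/
def Concurrent {I : Type*} (ℓ : I → Set ProjPlane) (T : Finset I) : Prop :=
  ∃ p, ∀ x ∈ T, p ∈ ℓ x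

/-- The labels of the lines in the class of `x` that are different from `x`. -/
def coLabels {G : Type*} [Fintype G] (x : Fin 3 × G) : Finset (Fin 3 × G) :=
  Finset.univ.filter fun y => y.1 = x.1 ∧ y.2 ≠ x.2

/-- The labels `(c, f c)`. -/
def graphLabels {G : Type*} [Fintype G] (f : Fin 3 → G) : Finset (Fin 3 × G) :=
  Finset.univ.filter fun y => y.2 = f y.1

lemma mem_coLabels {G : Type*} [Fintype G] {x y : Fin 3 × G} :
    y ∈ coLabels x ↔ y.1 = x.1 ∧ y.2 ≠ x.2 := by
  simp [coLabels]

lemma mem_graphLabels {G : Type*} [Fintype G] {f : Fin 3 → G} {y : Fin 3 × G} :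
    y ∈ graphLabels f ↔ y.2 = f y.1 := by
  simp [graphLabels]

lemma card_coLabels {G : Type*} [Fintype G] (x : Fin 3 × G) :
    (coLabels x).card = Fintype.card G - 1 := by
  have : coLabels x = (Finset.univ.erase x.2).image (Prod.mk x.1) := by
    ext ⟨c, g⟩
    simp only [mem_coLabels, Finset.mem_image, Finset.mem_erase, Finset.mem_univ, and_true,
      Prod.mk.injEq, exists_eq_right_right]
    tauto
  rw [this, Finset.card_image_of_injective _ (Prod.mk_right_injective _),
    Finset.card_erase_of_mem (Finset.mem_univ _), Finset.card_univ]

lemma card_graphLabels {G : Type*} [Fintype G] (f : Fin 3 → G) : (graphLabels f).card = 3 := by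
  have : graphLabels f = Finset.univ.image fun c => (c, f c) := by
    ext ⟨c, g⟩
    simp [mem_graphLabels, eq_comm]
  rw [this, Finset.card_image_of_injective _ fun c d h => (Prod.ext_iff.1 h).1]
  simp

lemma coLabels_ne_graphLabels {G : Type*} [Fintype G]
    (x : Fin 3 × G) (f : Fin 3 → G) : coLabels x ≠ graphLabels f := fun h => by
  have h1 : ∀ c, c = x.1 := fun c => by
    have : (c, f c) ∈ coLabels x := h ▸ mem_graphLabels.2 rfl
    exact (mem_coLabels.1 this).1
  exact absurd ((h1 0).trans (h1 1).symm) (by decide)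

lemma coLabels_injective {G : Type*} [Fintype G] (hG : Fintype.card G = 4) :
    Function.Injective (coLabels : Fin 3 × G → _) := fun x y h => by
  have key : ∀ z : Fin 3 × G, (z.1 = x.1 ∧ z.2 ≠ x.2) ↔ (z.1 = y.1 ∧ z.2 ≠ y.2) := fun z => by
    rw [← mem_coLabels, ← mem_coLabels, h]
  have : Nontrivial G := Fintype.one_lt_card_iff_nontrivial.1 (by omega)
  obtain ⟨g, hg⟩ := exists_ne x.2
  have h1 : x.1 = y.1 := ((key (x.1, g)).1 ⟨rfl, hg⟩).1
  refine Prod.ext h1 ?_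
  by_contra h2
  exact ((key (y.1, x.2)).2 ⟨rfl, h2⟩).2 rfl

lemma exists_perm_of_ncard_eq {Z W : Set (Fin 3)} (h : Z.ncard = W.ncard) :
    ∃ π : Equiv.Perm (Fin 3), ∀ c, c ∈ Z ↔ π c ∈ W := by
  obtain ⟨e⟩ : Nonempty ({c // c ∈ Z} ≃ {c // c ∈ W}) := by
    rwa [← Fintype.card_eq, ← Nat.card_eq_fintype_card, ← Nat.card_eq_fintype_card]
  refine ⟨e.extendSubtype, fun c => ⟨fun hc => e.extendSubtype_mem c hc, fun hc => ?_⟩⟩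
  by_contra hcZ
  exact e.extendSubtype_not_mem c hcZ hc

/-- A family of lines labelled by three copies of a group of order `4` which forms a net with
points of multiplicity at most `3`, the mixed triple points being the zero-sum triples. -/
structure IsGroupNet {G : Type*} [AddCommGroup G] [Fintype G]
    (ℓ : Fin 3 × G → Set ProjPlane) : Prop where
  card_eq : Fintype.card G = 4
  line : ∀ x, IsProjLine (ℓ x)
  inj : Function.Injective ℓ
  mixed : ∀ f : Fin 3 → G, f 0 + f 1 + f 2 = 0 → ∃ p, ∀ c, p ∈ ℓ (c, f c)
  net : ∀ x y p, p ∈ ℓ x → p ∈ ℓ y → x.1 ≠ y.1 → ∀ m, ∃! g, p ∈ ℓ (m, g)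
  card_le : ∀ p, (Finset.univ.filter fun x => p ∈ ℓ x).card ≤ 3

namespace IsGroupNet

variable {G : Type*} [AddCommGroup G] [Fintype G] {ℓ ℓ' : Fin 3 × G → Set ProjPlane}

lemma point_unique (h : IsGroupNet ℓ) {x y : Fin 3 × G} (hxy : x ≠ y) {p q : ProjPlane}
    (hpx : p ∈ ℓ x) (hpy : p ∈ ℓ y) (hqx : q ∈ ℓ x) (hqy : q ∈ ℓ y) : p = q :=
  (h.line x).inter_unique (h.line y) (h.inj.ne hxy) hpx hqx hpy hqy

lemma card_le_three (h : IsGroupNet ℓ) {T : Finset (Fin 3 × G)} (hT : Concurrent ℓ T) :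
    T.card ≤ 3 := by
  obtain ⟨p, hp⟩ := hT
  exact (Finset.card_le_card fun x hx => by simpa using hp x hx).trans (h.card_le p)

lemma exists_vec (h : IsGroupNet ℓ) : ∃ v : Fin 3 × G → Fin 3 → ℂ,
    ∀ x y z, Concurrent ℓ {x, y, z} ↔ tripleDet (v x) (v y) (v z) = 0 := by
  choose v _ hv using fun x => (h.line x).exists_vec
  refine ⟨v, fun x y z => ?_⟩
  rw [← exists_point_iff_tripleDet]
  simp [Concurrent, hv]

lemma concurrent_of_card_le_two (h : IsGroupNet ℓ) {T : Finset (Fin 3 × G)} (hT : T.card ≤ 2) :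
    Concurrent ℓ T := by
  obtain ⟨v, hv⟩ := h.exists_vec
  have pair : ∀ x y, Concurrent ℓ {x, y} := fun x y => by
    have : Concurrent ℓ {x, x, y} := (hv x x y).2 (by rw [tripleDet_eq]; ring)
    simpa using this
  obtain h0 | h1 | h2 : T.card = 0 ∨ T.card = 1 ∨ T.card = 2 := by omega
  · rw [Finset.card_eq_zero.1 h0]
    obtain ⟨p, -⟩ := pair (0, 0) (0, 0)
    exact ⟨p, by simp⟩
  · obtain ⟨x, rfl⟩ := Finset.card_eq_one.1 h1
    simpa using pair x x
  · obtain ⟨x, y, -, rfl⟩ := Finset.card_eq_two.1 h2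
    exact pair x y

/-- The triples of concurrent lines: mixed triples with zero sum, and triples within a class. -/
lemma concurrent_iff (h : IsGroupNet ℓ) {T : Finset (Fin 3 × G)} (hT : T.card = 3) :
    Concurrent ℓ T ↔ (∃ f : Fin 3 → G, f 0 + f 1 + f 2 = 0 ∧ T = graphLabels f) ∨
      ∃ x, Concurrent ℓ (coLabels x) ∧ T = coLabels x := by
  constructor
  · rintro ⟨p, hp⟩
    by_cases hc : ∃ x ∈ T, ∃ y ∈ T, x.1 ≠ y.1
    · left
      obtain ⟨x, hx, y, hy, hxy⟩ := hc
      choose f hf hfu using h.net x y p (hp x hx) (hp y hy) hxy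
      have hTf : T = graphLabels f := by
        refine Finset.eq_of_subset_of_card_le (fun z hz => mem_graphLabels.2 ?_) ?_
        · exact hfu z.1 z.2 (hp z hz)
        · rw [hT, card_graphLabels]
      refine ⟨f, ?_, hTf⟩
      obtain ⟨q, hq⟩ := h.mixed ![f 0, f 1, -(f 0 + f 1)] (by simp)
      have hpq : p = q := h.point_unique (x := (0, f 0)) (y := (1, f 1)) (by simp)
        (hf 0) (hf 1) (hq 0) (hq 1)
      have := hfu 2 _ (hpq ▸ hq 2)
      simp only [Matrix.cons_val] at this
      rw [← this]
      abel
    · right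
      push Not at hc
      obtain ⟨x₀, hx₀⟩ : T.Nonempty := Finset.card_pos.1 (by omega)
      have hinj : Set.InjOn Prod.snd (T : Set (Fin 3 × G)) := fun x hx y hy hxy =>
        Prod.ext (hc x hx y hy) hxy
      have hcard : (T.image Prod.snd).card = 3 := by rw [Finset.card_image_of_injOn hinj, hT]
      have : ∃ g, g ∉ T.image Prod.snd := by
        by_contra! hall
        have := Finset.card_le_card fun g (_ : g ∈ Finset.univ) => hall g
        rw [Finset.card_univ, h.card_eq] at this
        omega
      obtain ⟨g, hg⟩ := this
      have hTg : T = coLabels (x₀.1, g) := by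
        refine Finset.eq_of_subset_of_card_le (fun z hz => mem_coLabels.2 ⟨hc z hz x₀ hx₀, ?_⟩) ?_
        · rintro rfl
          exact hg (Finset.mem_image_of_mem _ hz)
        · rw [hT, card_coLabels, h.card_eq]
      exact ⟨_, hTg ▸ ⟨p, hp⟩, hTg⟩
  · rintro (⟨f, hf, rfl⟩ | ⟨x, hx, rfl⟩)
    · obtain ⟨p, hp⟩ := h.mixed f hf
      refine ⟨p, fun x hx => ?_⟩
      have := hp x.1
      rwa [← mem_graphLabels.1 hx] at this
    · exact hx

/-- In each class there is at most one line missing a triple point of that class. -/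
lemma coLabels_unique (h : IsGroupNet ℓ) {c : Fin 3} {g g' : G}
    (hg : Concurrent ℓ (coLabels (c, g))) (hg' : Concurrent ℓ (coLabels (c, g'))) : g = g' := by
  by_contra hne
  obtain ⟨p, hp⟩ := hg
  obtain ⟨q, hq⟩ := hg'
  have hcard : 1 < ((Finset.univ : Finset G) \ {g, g'}).card := by
    rw [Finset.card_sdiff_of_subset (Finset.subset_univ _), Finset.card_univ, h.card_eq,
      Finset.card_pair hne]
    omega
  obtain ⟨k, hk, l, hl, hkl⟩ := Finset.one_lt_card.1 hcard
  simp only [Finset.mem_sdiff, Finset.mem_univ, Finset.mem_insert, Finset.mem_singleton, not_or,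
    true_and] at hk hl
  have hpq : p = q := h.point_unique (x := (c, k)) (y := (c, l)) (by simpa using hkl)
    (hp _ (mem_coLabels.2 ⟨rfl, hk.1⟩)) (hp _ (mem_coLabels.2 ⟨rfl, hl.1⟩))
    (hq _ (mem_coLabels.2 ⟨rfl, hk.2⟩)) (hq _ (mem_coLabels.2 ⟨rfl, hl.2⟩))
  have hall : Concurrent ℓ (Finset.univ.image fun a : G => (c, a)) := by
    refine ⟨p, fun x hx => ?_⟩
    obtain ⟨a, -, rfl⟩ := Finset.mem_image.1 hx
    by_cases ha : a = g
    · rw [hpq]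
      exact hq _ (mem_coLabels.2 ⟨rfl, fun h' => hne (ha.symm.trans h')⟩)
    · exact hp _ (mem_coLabels.2 ⟨rfl, ha⟩)
  have := h.card_le_three hall
  rw [Finset.card_image_of_injective _ (Prod.mk_right_injective c), Finset.card_univ,
    h.card_eq] at this
  omega

lemma not_concurrent (h : IsGroupNet ℓ) {c d : Fin 3} {g g' k : G} (hcd : c ≠ d) (hg : g ≠ g')
    {T : Finset (Fin 3 × G)} (h1 : (c, g) ∈ T) (h2 : (c, g') ∈ T) (h3 : (d, k) ∈ T) :
    ¬ Concurrent ℓ T := by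
  rintro ⟨p, hp⟩
  exact hg ((h.net _ _ p (hp _ h1) (hp _ h3) hcd c).unique (hp _ h1) (hp _ h2))

/-- By Pappus' theorem, triple points in two classes force one in the third class. -/
lemma concurrent_coLabels_two (h : IsGroupNet ℓ) {x y : G}
    (hx : Concurrent ℓ (coLabels (0, x))) (hy : Concurrent ℓ (coLabels (1, y))) :
    Concurrent ℓ (coLabels (2, -(x + y) - ∑ g : G, g)) := by
  obtain ⟨v, hv⟩ := h.exists_vec
  have hcard : ((Finset.univ : Finset G).erase 0).card = 3 := by
    rw [Finset.card_erase_of_mem (Finset.mem_univ _), Finset.card_univ, h.card_eq]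
  obtain ⟨p, q, r, hpq, hpr, hqr, hpqr⟩ := Finset.card_eq_three.1 hcard
  have hne : ∀ g, g ≠ 0 ↔ g = p ∨ g = q ∨ g = r := fun g => by
    simpa using Finset.ext_iff.1 hpqr g
  have hsum : ∑ g : G, g = p + q + r := by
    rw [← Finset.add_sum_erase _ _ (Finset.mem_univ 0), hpqr, Finset.sum_insert (by simp [*]),
      Finset.sum_pair hqr]
    abel
  have hco : ∀ (c : Fin 3) (z : G), coLabels (c, z) = {(c, z + p), (c, z + q), (c, z + r)} := by
    rintro c z
    ext ⟨d, g⟩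
    have := hne (g - z)
    simp only [sub_ne_zero, sub_eq_iff_eq_add'] at this
    simp only [mem_coLabels, this, Finset.mem_insert, Finset.mem_singleton, Prod.mk.injEq]
    tauto
  have hmix : ∀ a b c : G, a + b + c = 0 → tripleDet (v (0, a)) (v (1, b)) (v (2, c)) = 0 := by
    intro a b c habc
    obtain ⟨s, hs⟩ := h.mixed ![a, b, c] (by simpa using habc)
    refine (hv _ _ _).1 ⟨s, ?_⟩
    simpa using ⟨hs 0, hs 1, hs 2⟩
  have hnon : ∀ {c d : Fin 3} {g g' k : G} {a b e : Fin 3 × G}, c ≠ d → g ≠ g' →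
      (c, g) ∈ ({a, b, e} : Finset _) → (c, g') ∈ ({a, b, e} : Finset _) →
      (d, k) ∈ ({a, b, e} : Finset _) → tripleDet (v a) (v b) (v e) ≠ 0 := by
    intro c d g g' k a b e hcd hg h1 h2 h3
    rw [Ne, ← hv]
    exact h.not_concurrent hcd hg h1 h2 h3
  have h01 : (0 : Fin 3) ≠ 1 := by decide
  rw [hco, hv] at hx hy ⊢
  rw [hsum]
  refine pappus hx hy (hmix _ _ _ (by abel)) (hmix _ _ _ (by abel)) (hmix _ _ _ (by abel))
    (hmix _ _ _ (by abel)) (hmix _ _ _ (by abel)) (hmix _ _ _ (by abel)) ?_ ?_ ?_ ?_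
  · exact hnon (c := 0) (d := 1) (g := x + p) (g' := x + q) (k := y + p) h01 (by simpa)
      (by simp) (by simp) (by simp)
  · exact hnon (c := 1) (d := 0) (g := y + p) (g' := y + q) (k := x + p) h01.symm (by simpa)
      (by simp) (by simp) (by simp)
  · exact hnon (c := 0) (d := 1) (g := x + q) (g' := x + r) (k := y + p) h01 (by simpa)
      (by simp) (by simp) (by simp)
  · exact hnon (c := 1) (d := 0) (g := y + p) (g' := y + r) (k := x + p) h01.symm (by simpa)
      (by simp) (by simp) (by simp)

lemma mult_eq (h : IsGroupNet ℓ) {A : Finset (Set ProjPlane)} (hA : A = Finset.univ.image ℓ)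
    (p : ProjPlane) : mult A p = (Finset.univ.filter fun x => p ∈ ℓ x).card := by
  rw [mult, linesThrough, hA, Finset.filter_image, Finset.card_image_of_injective _ h.inj]

lemma ncard_mult_three (h : IsGroupNet ℓ) {A : Finset (Set ProjPlane)}
    (hA : A = Finset.univ.image ℓ) : {p : ProjPlane | mult A p = 3}.ncard =
      {T : Finset (Fin 3 × G) | T.card = 3 ∧ Concurrent ℓ T}.ncard := by
  refine Set.ncard_congr (fun p _ => Finset.univ.filter fun x => p ∈ ℓ x) ?_ ?_ ?_
  · intro p hp
    exact ⟨(h.mult_eq hA p).symm.trans hp, p, fun x hx => (Finset.mem_filter.1 hx).2⟩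
  · intro p q hp hq hpq
    have hp3 := (h.mult_eq hA p).symm.trans hp
    obtain ⟨x, hx, y, hy, hxy⟩ := Finset.one_lt_card.1 (hp3 ▸ (by omega : 1 < 3))
    have hx' := hpq ▸ hx
    have hy' := hpq ▸ hy
    simp only [Finset.mem_filter, Finset.mem_univ, true_and] at hx hy hx' hy'
    exact h.point_unique hxy hx hy hx' hy'
  · rintro T ⟨hT, p, hp⟩
    have hsub : T ⊆ Finset.univ.filter fun x => p ∈ ℓ x := fun x hx => by simpa using hp x hx
    have heq := Finset.eq_of_subset_of_card_le hsub ((h.card_le p).trans hT.ge)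
    refine ⟨p, ?_, heq.symm⟩
    rw [Set.mem_ofPred_eq, h.mult_eq hA, ← heq, hT]

lemma ncard_triples (h : IsGroupNet ℓ) :
    {T : Finset (Fin 3 × G) | T.card = 3 ∧ Concurrent ℓ T}.ncard =
      {T | ∃ f : Fin 3 → G, f 0 + f 1 + f 2 = 0 ∧ T = graphLabels f}.ncard +
        {x : Fin 3 × G | Concurrent ℓ (coLabels x)}.ncard := by
  rw [← Set.ncard_image_of_injective _ (coLabels_injective h.card_eq),
    ← Set.ncard_union_eq _ (Set.toFinite _) (Set.toFinite _)]
  · congr 1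
    ext T
    simp only [Set.mem_ofPred_eq, Set.mem_union, Set.mem_image]
    constructor
    · rintro ⟨hT, hc⟩
      refine ((h.concurrent_iff hT).1 hc).imp_right ?_
      rintro ⟨x, hx, rfl⟩
      exact ⟨x, hx, rfl⟩
    · rintro (⟨f, hf, rfl⟩ | ⟨x, hx, rfl⟩)
      · exact ⟨card_graphLabels f,
          (h.concurrent_iff (card_graphLabels f)).2 (Or.inl ⟨f, hf, rfl⟩)⟩
      · exact ⟨by rw [card_coLabels, h.card_eq], hx⟩
  · rw [Set.disjoint_left]
    rintro _ ⟨f, -, rfl⟩ ⟨x, -, hx⟩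
    exact coLabels_ne_graphLabels x f hx

/-- If every class has a triple point, the omitted labels have a prescribed sum. -/
lemma sum_omitted (h : IsGroupNet ℓ) {w : Fin 3 → G}
    (hw : ∀ c, Concurrent ℓ (coLabels (c, w c))) : ∑ c, w c = -∑ g : G, g := by
  rw [Fin.sum_univ_three, h.coLabels_unique (hw 2) (h.concurrent_coLabels_two (hw 0) (hw 1))]
  abel

/-- Two group nets with equally many unmixed triple points have the same unmixed triple points up
to a permutation of the classes and translations. -/
lemma exists_relabelling (h : IsGroupNet ℓ) (h' : IsGroupNet ℓ')
    (hcard : {x : Fin 3 × G | Concurrent ℓ (coLabels x)}.ncard =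
      {x : Fin 3 × G | Concurrent ℓ' (coLabels x)}.ncard) :
    ∃ (π : Equiv.Perm (Fin 3)) (t : Fin 3 → G), ∑ c, t c = 0 ∧
      ∀ c g, Concurrent ℓ (coLabels (c, g)) ↔ Concurrent ℓ' (coLabels (π c, g + t c)) := by
  have proj : ∀ {ℓ : Fin 3 × G → Set ProjPlane}, IsGroupNet ℓ →
      {c | ∃ g, Concurrent ℓ (coLabels (c, g))}.ncard =
        {x : Fin 3 × G | Concurrent ℓ (coLabels x)}.ncard := fun {ℓ} h => by
    rw [← Set.InjOn.ncard_image (f := Prod.fst)]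
    · congr 1
      ext c
      simp
    · rintro ⟨c, g⟩ hx ⟨d, g'⟩ hy rfl
      rw [h.coLabels_unique hx hy]
  obtain ⟨π, hπ⟩ := exists_perm_of_ncard_eq ((proj h).trans (hcard.trans (proj h').symm))
  simp only [Set.mem_ofPred_eq] at hπ
  have omitted : ∀ {ℓ : Fin 3 × G → Set ProjPlane}, ∃ w : Fin 3 → G, ∀ c,
      (∃ g, Concurrent ℓ (coLabels (c, g))) → Concurrent ℓ (coLabels (c, w c)) := fun {ℓ} =>
    ⟨fun c => if hc : ∃ g, Concurrent ℓ (coLabels (c, g)) then hc.choose else 0, fun c hc => by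
      simp only [dif_pos hc]
      exact hc.choose_spec⟩
  obtain ⟨w, hw⟩ := omitted (ℓ := ℓ)
  obtain ⟨w', hw'⟩ := omitted (ℓ := ℓ')
  suffices ∃ t : Fin 3 → G, ∑ c, t c = 0 ∧
      ∀ c, (∃ g, Concurrent ℓ (coLabels (c, g))) → t c = w' (π c) - w c by
    obtain ⟨t, ht, htw⟩ := this
    refine ⟨π, t, ht, fun c g => ⟨fun hg => ?_, fun hg => ?_⟩⟩
    · have hc : ∃ g, Concurrent ℓ (coLabels (c, g)) := ⟨g, hg⟩
      rw [htw c hc, h.coLabels_unique hg (hw c hc), add_sub_cancel]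
      exact hw' _ ((hπ c).1 hc)
    · have hc' : ∃ g, Concurrent ℓ' (coLabels (π c, g)) := ⟨_, hg⟩
      have hc := (hπ c).2 hc'
      have := h'.coLabels_unique hg (hw' _ hc')
      rw [htw c hc, ← add_sub_assoc, sub_eq_iff_eq_add, add_comm, add_right_inj] at this
      rw [this]
      exact hw c hc
  by_cases hall : ∀ c, ∃ g, Concurrent ℓ (coLabels (c, g))
  · refine ⟨fun c => w' (π c) - w c, ?_, fun c _ => rfl⟩
    have hall' : ∀ c, Concurrent ℓ' (coLabels (c, w' c)) := fun c =>
      hw' c (by simpa using (hπ (π.symm c)).1 (hall _))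
    rw [Finset.sum_sub_distrib, Equiv.sum_comp π w', h'.sum_omitted hall',
      h.sum_omitted fun c => hw c (hall c), sub_self]
  · push Not at hall
    obtain ⟨c₀, hc₀⟩ := hall
    refine ⟨Function.update (fun c => w' (π c) - w c) c₀
      (-∑ c ∈ Finset.univ \ {c₀}, (w' (π c) - w c)), ?_, fun c hc => ?_⟩
    · rw [Finset.sum_update_of_mem (Finset.mem_univ _), neg_add_cancel]
    · refine Function.update_of_ne ?_ _ _
      rintro rfl
      obtain ⟨g, hg⟩ := hc
      exact hc₀ g hg

/-- Permute the classes of labels by `π` and translate the class `c` by `t c`. -/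
def relabel (π : Equiv.Perm (Fin 3)) (t : Fin 3 → G) : Equiv.Perm (Fin 3 × G) where
  toFun x := (π x.1, x.2 + t x.1)
  invFun y := (π.symm y.1, y.2 - t (π.symm y.1))
  left_inv x := by simp
  right_inv y := by simp

lemma map_coLabels (π : Equiv.Perm (Fin 3)) (t : Fin 3 → G) (x : Fin 3 × G) :
    (coLabels x).map (relabel π t).toEmbedding = coLabels (relabel π t x) := by
  ext y
  simp only [relabel, Finset.mem_map_equiv, Equiv.coe_fn_symm_mk, mem_coLabels,
    Equiv.symm_apply_eq, Equiv.coe_fn_mk, and_congr_right_iff]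
  intro h
  rw [h, Equiv.symm_apply_apply, Ne, sub_eq_iff_eq_add]

lemma map_graphLabels (π : Equiv.Perm (Fin 3)) (t : Fin 3 → G) (f : Fin 3 → G) :
    (graphLabels f).map (relabel π t).toEmbedding =
      graphLabels fun c => f (π.symm c) + t (π.symm c) := by
  ext y
  simp [Finset.mem_map_equiv, mem_graphLabels, relabel, sub_eq_iff_eq_add]

lemma concurrent_map_iff (h : IsGroupNet ℓ) (h' : IsGroupNet ℓ') {π : Equiv.Perm (Fin 3)}
    {t : Fin 3 → G} (ht : ∑ c, t c = 0)
    (ho : ∀ c g, Concurrent ℓ (coLabels (c, g)) ↔ Concurrent ℓ' (coLabels (π c, g + t c)))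
    (T : Finset (Fin 3 × G)) :
    Concurrent ℓ T ↔ Concurrent ℓ' (T.map (relabel π t).toEmbedding) := by
  have hmap := Finset.card_map (s := T) (relabel π t).toEmbedding
  obtain hT | hT | hT : T.card ≤ 2 ∨ 3 < T.card ∨ T.card = 3 := by omega
  · exact iff_of_true (h.concurrent_of_card_le_two hT) (h'.concurrent_of_card_le_two (hmap ▸ hT))
  · exact iff_of_false (fun hc => (h.card_le_three hc).not_gt hT)
      fun hc => (h'.card_le_three hc).not_gt (hmap ▸ hT)
  rw [h.concurrent_iff hT, h'.concurrent_iff (hmap.trans hT)]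
  refine or_congr ⟨?_, ?_⟩ ⟨?_, ?_⟩
  · rintro ⟨f, hf, rfl⟩
    refine ⟨_, ?_, map_graphLabels π t f⟩
    rw [← Fin.sum_univ_three fun c => f (π.symm c) + t (π.symm c),
      Equiv.sum_comp π.symm fun c => f c + t c, Finset.sum_add_distrib, ht, add_zero,
      Fin.sum_univ_three, hf]
  · rintro ⟨f, hf, hT⟩
    refine ⟨fun c => f (π c) - t c, ?_, ?_⟩
    · rw [← Fin.sum_univ_three fun c => f (π c) - t c, Finset.sum_sub_distrib,
        Equiv.sum_comp π f, ht, sub_zero, Fin.sum_univ_three, hf]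
    · refine Finset.map_injective (relabel π t).toEmbedding ?_
      rw [hT, map_graphLabels]
      simp
  · rintro ⟨x, hx, rfl⟩
    exact ⟨_, (ho _ _).1 hx, map_coLabels π t x⟩
  · rintro ⟨y, hy, hT⟩
    obtain ⟨x, rfl⟩ := (relabel π t).surjective y
    exact ⟨x, (ho _ _).2 hy, Finset.map_injective _ (hT.trans (map_coLabels π t x).symm)⟩

/-- Group nets for the same group with equally many triple points are lattice isomorphic. -/
lemma latticeIso (h : IsGroupNet ℓ) (h' : IsGroupNet ℓ') {A B : Finset (Set ProjPlane)}
    (hA : A = Finset.univ.image ℓ) (hB : B = Finset.univ.image ℓ')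
    (ht : {p : ProjPlane | mult A p = 3}.ncard = {p : ProjPlane | mult B p = 3}.ncard) :
    LatticeIso A B := by
  rw [h.ncard_mult_three hA, h'.ncard_mult_three hB, h.ncard_triples, h'.ncard_triples,
    Nat.add_left_cancel_iff] at ht
  obtain ⟨π, t, hsum, ho⟩ := h.exists_relabelling h' ht
  set φ : Set ProjPlane → Set ProjPlane := Function.extend ℓ (ℓ' ∘ relabel π t) id with hφ
  have hφℓ : ∀ x, φ (ℓ x) = ℓ' (relabel π t x) := h.inj.extend_apply _ _
  refine ⟨φ, ⟨?_, ?_, ?_⟩, fun S hS => ?_⟩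
  · intro X hX
    obtain ⟨x, rfl⟩ : ∃ x, ℓ x = X := by simpa [hA] using hX
    simp [hB, hφℓ]
  · intro X hX Y hY hXY
    obtain ⟨x, rfl⟩ : ∃ x, ℓ x = X := by simpa [hA] using hX
    obtain ⟨y, rfl⟩ : ∃ x, ℓ x = Y := by simpa [hA] using hY
    rw [hφℓ, hφℓ] at hXY
    rw [(relabel π t).injective (h'.inj hXY)]
  · intro Y hY
    obtain ⟨y, rfl⟩ : ∃ x, ℓ' x = Y := by simpa [hB] using hY
    obtain ⟨x, rfl⟩ := (relabel π t).surjective y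
    exact ⟨ℓ x, by simp [hA], hφℓ x⟩
  · obtain ⟨T, -, rfl⟩ := Finset.subset_image_iff.1 (hA ▸ hS)
    simpa only [Concurrent, Finset.forall_mem_image, Finset.forall_mem_map, hφℓ,
      Equiv.coe_toEmbedding] using h.concurrent_map_iff h' hsum ho T

end IsGroupNet

/-- A net encoded by the addition table of a group of order `4` is a group net. -/
lemma exists_isGroupNet {G : Type*} [AddCommGroup G] [Fintype G] (e : Fin 4 ≃ G)
    {M : Fin 4 → Fin 4 → Fin 4} (hM : ∀ i j, e (M i j) = e i + e j)
    {A : Finset (Set ProjPlane)} {C : Fin 3 → Finset (Set ProjPlane)} (hA : IsNet 3 4 A C)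
    (hAm : ∀ p : ProjPlane, IsMultPoint A p → mult A p = 2 ∨ mult A p = 3)
    (hAe : EncodedBy C M) :
    ∃ ℓ : Fin 3 × G → Set ProjPlane, IsGroupNet ℓ ∧ A = Finset.univ.image ℓ := by
  obtain ⟨L, hL, hconc⟩ := hAe
  obtain ⟨hline, -, hcard, hdisj, hsub, hcov, hnet⟩ := hA
  let s : Fin 3 → Equiv.Perm G := ![Equiv.refl G, Equiv.refl G, Equiv.neg G]
  let ℓ : Fin 3 × G → Set ProjPlane := fun x => L x.1 (e.symm (s x.1 x.2))
  have hmem : ∀ x, ℓ x ∈ C x.1 := fun x => by simp [hL, ℓ]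
  have hC : ∀ c X, X ∈ C c ↔ ∃ g, ℓ (c, g) = X := fun c X => by
    simp [hL, ℓ, (e.symm.surjective.comp (s c).surjective).exists]
  have hLinj : ∀ c, Function.Injective (L c) := fun c => by
    have : (Finset.univ.image (L c)).card = (Finset.univ : Finset (Fin 4)).card := by
      rw [← hL, hcard, Finset.card_univ, Fintype.card_fin]
    simpa [Set.injOn_univ] using Finset.card_image_iff.1 this
  have hinj : Function.Injective ℓ := by
    rintro ⟨c, g⟩ ⟨d, k⟩ hx
    have hcd : c = d := by
      by_contra hne
      exact Finset.disjoint_left.1 (hdisj c d hne) (hmem (c, g)) (hx ▸ hmem (d, k))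
    subst hcd
    exact Prod.ext rfl ((s c).injective (e.symm.injective (hLinj c hx)))
  have hAℓ : A = Finset.univ.image ℓ := by
    ext X
    simp only [Finset.mem_image, Finset.mem_univ, true_and]
    constructor
    · intro hX
      obtain ⟨c, hc⟩ := hcov X hX
      obtain ⟨g, hg⟩ := (hC c X).1 hc
      exact ⟨_, hg⟩
    · rintro ⟨x, rfl⟩
      exact hsub _ (hmem x)
  refine ⟨ℓ, ⟨?_, fun x => hline _ (hsub _ (hmem x)), hinj, ?_, ?_, ?_⟩, hAℓ⟩
  · rw [← Fintype.card_congr e, Fintype.card_fin]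
  · intro f hf
    obtain ⟨p, h0, h1, h2⟩ := hconc (e.symm (f 0)) (e.symm (f 1))
    have hM' : M (e.symm (f 0)) (e.symm (f 1)) = e.symm (-f 2) := by
      rw [Equiv.eq_symm_apply, hM, e.apply_symm_apply, e.apply_symm_apply]
      exact eq_neg_of_add_eq_zero_left hf
    rw [hM'] at h2
    refine ⟨p, fun c => ?_⟩
    fin_cases c
    exacts [h0, h1, h2]
  · intro x y p hpx hpy hxy m
    obtain ⟨N, ⟨hN, hpN⟩, hu⟩ := hnet x.1 y.1 hxy _ (hmem x) _ (hmem y) p hpx hpy m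
    obtain ⟨g, rfl⟩ := (hC m N).1 hN
    refine ⟨g, hpN, fun g' hg' => ?_⟩
    have := hinj (hu _ ⟨hmem (m, g'), hg'⟩)
    exact (Prod.ext_iff.1 this).2
  · intro p
    have : mult A p = (Finset.univ.filter fun x => p ∈ ℓ x).card := by
      rw [mult, linesThrough, hAℓ, Finset.filter_image, Finset.card_image_of_injective _ hinj]
    rw [← this]
    by_cases hp : IsMultPoint A p
    · have := hAm p hp
      omega
    · rw [IsMultPoint] at hp
      omega

lemma latticeIso_of_encodedBy_group {G : Type*} [AddCommGroup G] [Fintype G] (e : Fin 4 ≃ G)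
    {M : Fin 4 → Fin 4 → Fin 4} (hM : ∀ i j, e (M i j) = e i + e j)
    {A B : Finset (Set ProjPlane)} {CA CB : Fin 3 → Finset (Set ProjPlane)}
    (hA : IsNet 3 4 A CA) (hB : IsNet 3 4 B CB)
    (hAm : ∀ p : ProjPlane, IsMultPoint A p → mult A p = 2 ∨ mult A p = 3)
    (hBm : ∀ p : ProjPlane, IsMultPoint B p → mult B p = 2 ∨ mult B p = 3)
    (hAe : EncodedBy CA M) (hBe : EncodedBy CB M)
    (ht : {p : ProjPlane | mult A p = 3}.ncard = {p : ProjPlane | mult B p = 3}.ncard) :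
    LatticeIso A B := by
  obtain ⟨ℓ, h, hAℓ⟩ := exists_isGroupNet e hM hA hAm hAe
  obtain ⟨ℓ', h', hBℓ⟩ := exists_isGroupNet e hM hB hBm hBe
  exact h.latticeIso h' hAℓ hBℓ ht

/-- The labelling of the rows of `M2` by the Klein four-group. -/
def kleinEquiv : Fin 4 ≃ ZMod 2 × ZMod 2 where
  toFun := ![(0, 0), (1, 0), (0, 1), (1, 1)]
  invFun x := if x.1 = 0 then (if x.2 = 0 then 0 else 2) else (if x.2 = 0 then 1 else 3)
  left_inv := by decide
  right_inv := by decide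

/-- two (3,4)-nets with only double and triple points, encoded by the same
Latin square `M ∈ {M1, M2}` and having equal numbers of triple points, are lattice
isomorphic. -/
theorem statement8 (M : Fin 4 → Fin 4 → Fin 4) (hM : M = M1 ∨ M = M2)
    (A B : Finset (Set ProjPlane)) (CA CB : Fin 3 → Finset (Set ProjPlane))
    (hA : IsNet 3 4 A CA) (hB : IsNet 3 4 B CB)
    (hAm : ∀ p : ProjPlane, IsMultPoint A p → mult A p = 2 ∨ mult A p = 3)
    (hBm : ∀ p : ProjPlane, IsMultPoint B p → mult B p = 2 ∨ mult B p = 3)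
    (hAe : EncodedBy CA M) (hBe : EncodedBy CB M)
    (ht : {p : ProjPlane | mult A p = 3}.ncard = {p : ProjPlane | mult B p = 3}.ncard) :
    LatticeIso A B := by
  rcases hM with rfl | rfl
  · exact latticeIso_of_encodedBy_group (G := ZMod 4) (Equiv.refl _) (by decide) hA hB hAm hBm hAe
      hBe ht
  · exact latticeIso_of_encodedBy_group kleinEquiv (by decide) hA hB hAm hBm hAe hBe ht
end
end

section
/- Let A be an arrangement of 14 distinct lines in P^2(C) all of whose multiple points have multiplicity at most 5. Then A admits no non-constant 2-cocycle η : A → F_2. -/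
open scoped Classical

noncomputable section

/-- The determinant of three vectors of `ℂ³`. -/
def bracket (x y z : Fin 3 → ℂ) : ℂ := (Matrix.of ![x, y, z]).det

theorem bracket_eq (x y z : Fin 3 → ℂ) :
    bracket x y z = x 0 * (y 1 * z 2 - y 2 * z 1) - x 1 * (y 0 * z 2 - y 2 * z 0)
      + x 2 * (y 0 * z 1 - y 1 * z 0) := by
  simp [bracket, Matrix.det_fin_three]
  ring

theorem bracket_vecMul (M : Matrix (Fin 3) (Fin 3) ℂ) (x y z : Fin 3 → ℂ) :
    bracket (Matrix.vecMul x M) (Matrix.vecMul y M) (Matrix.vecMul z M)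
      = bracket x y z * M.det := by
  rw [bracket, bracket, ← Matrix.det_mul]
  congr 1
  ext i j
  fin_cases i <;> rfl

theorem bracket_eq_zero_iff (x y z : Fin 3 → ℂ) :
    bracket x y z = 0 ↔
      ∃ v : Fin 3 → ℂ, v ≠ 0 ∧ x ⬝ᵥ v = 0 ∧ y ⬝ᵥ v = 0 ∧ z ⬝ᵥ v = 0 := by
  rw [bracket, ← Matrix.exists_mulVec_eq_zero_iff]
  refine exists_congr fun v => and_congr_right fun _ => ?_
  simp [funext_iff, Fin.forall_fin_succ]

/-- If a nonzero vector `k` is coplanar with each of the pairs `(a, b)`, `(c, d)`, `(e, f)`, then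
the normals of the planes spanned by these pairs are linearly dependent. -/
theorem bracket_relation {k a b c d e f : Fin 3 → ℂ} (hk : k ≠ 0) (h₁ : bracket k a b = 0)
    (h₂ : bracket k c d = 0) (h₃ : bracket k e f = 0) :
    bracket a c d * bracket b e f = bracket b c d * bracket a e f := by
  have h : bracket (crossProduct a b) (crossProduct c d) (crossProduct e f) = 0 := by
    rw [bracket_eq_zero_iff]
    refine ⟨k, hk, ?_, ?_, ?_⟩
    · rw [← h₁, bracket_eq]; simp [crossProduct, dotProduct, Fin.sum_univ_three]; ring
    · rw [← h₂, bracket_eq]; simp [crossProduct, dotProduct, Fin.sum_univ_three]; ring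
    · rw [← h₃, bracket_eq]; simp [crossProduct, dotProduct, Fin.sum_univ_three]; ring
  rw [← sub_eq_zero, ← h]
  simp only [bracket_eq, crossProduct, LinearMap.mk₂_apply]
  simp
  ring

/-- Five bracket relations among six vectors force a degeneracy. -/
theorem bracket_degenerate {v₁ v₂ v₃ v₄ v₅ v₆ : Fin 3 → ℂ} (h123 : bracket v₁ v₂ v₃ ≠ 0)
    (h126 : bracket v₁ v₂ v₆ ≠ 0) (h345 : bracket v₃ v₄ v₅ ≠ 0)
    (hA : bracket v₁ v₂ v₅ * bracket v₃ v₄ v₆ = bracket v₃ v₂ v₅ * bracket v₁ v₄ v₆)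
    (hB : bracket v₁ v₂ v₅ * bracket v₄ v₃ v₆ = bracket v₄ v₂ v₅ * bracket v₁ v₃ v₆)
    (hC : bracket v₁ v₂ v₆ * bracket v₄ v₃ v₅ = bracket v₄ v₂ v₆ * bracket v₁ v₃ v₅)
    (hD : bracket v₂ v₁ v₅ * bracket v₄ v₃ v₆ = bracket v₄ v₁ v₅ * bracket v₂ v₃ v₆)
    (hE : bracket v₂ v₁ v₆ * bracket v₄ v₃ v₅ = bracket v₄ v₁ v₆ * bracket v₂ v₃ v₅) :
    False := by
  set M : Matrix (Fin 3) (Fin 3) ℂ := Matrix.of ![v₁, v₂, v₃] with hM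
  have hdet : M.det ≠ 0 := h123
  have hu : IsUnit M.det := hdet.isUnit
  have e (v : Fin 3 → ℂ) : ∃ x : Fin 3 → ℂ, v = Matrix.vecMul x M :=
    ⟨Matrix.vecMul v M⁻¹, by rw [Matrix.vecMul_vecMul, Matrix.nonsing_inv_mul _ hu,
      Matrix.vecMul_one]⟩
  have e₁ : v₁ = Matrix.vecMul ![1, 0, 0] M := by simp [hM]
  have e₂ : v₂ = Matrix.vecMul ![0, 1, 0] M := by simp [hM]
  have e₃ : v₃ = Matrix.vecMul ![0, 0, 1] M := by simp [hM]
  obtain ⟨x, e₄⟩ := e v₄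
  obtain ⟨y, e₅⟩ := e v₅
  obtain ⟨z, e₆⟩ := e v₆
  clear_value M
  subst e₁ e₂ e₃ e₄ e₅ e₆
  have cancel {s t s' t' : ℂ} (h : s * M.det * (t * M.det) = s' * M.det * (t' * M.det)) :
      s * t = s' * t' := by
    apply mul_right_cancel₀ (mul_ne_zero hdet hdet)
    linear_combination h
  simp only [bracket_vecMul] at *
  replace hA := cancel hA
  replace hB := cancel hB
  replace hC := cancel hC
  replace hD := cancel hD
  replace hE := cancel hE
  replace h126 := left_ne_zero_of_mul h126
  replace h345 := left_ne_zero_of_mul h345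
  simp [bracket_eq] at hA hB hC hD hE h126 h345
  have key : z 2 * (y 0 * x 1 - y 1 * x 0) = 0 := by
    linear_combination (hA - hD + hB + hC) / 2 - hE
  rcases mul_eq_zero.1 key with h | h
  · exact h126 h
  · exact h345 (by linear_combination -h)

theorem IsProjLine.exists_normal {L : Set ProjPlane} (h : IsProjLine L) :
    ∃ n : Fin 3 → ℂ, n ≠ 0 ∧ ∀ (v : Fin 3 → ℂ) (hv : v ≠ 0),
      Projectivization.mk ℂ v hv ∈ L ↔ n ⬝ᵥ v = 0 := by
  obtain ⟨f, hf, rfl⟩ := h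
  have hfn (v : Fin 3 → ℂ) : (fun i => f (Pi.single i 1)) ⬝ᵥ v = f v := by
    rw [LinearMap.pi_apply_eq_sum_univ f v]
    refine Finset.sum_congr rfl fun i _ => ?_
    have hi : (Pi.single i 1 : Fin 3 → ℂ) = fun j => if i = j then 1 else 0 := by
      ext j
      simp [Pi.single_apply, eq_comm]
    simp only [smul_eq_mul, mul_comm, hi]
  refine ⟨fun i => f (Pi.single i 1), ?_, fun v hv => ?_⟩
  · rintro h0
    refine hf (LinearMap.ext fun v => ?_)
    rw [← hfn, h0]
    simp
  · obtain ⟨a, ha⟩ := Projectivization.exists_smul_eq_mk_rep ℂ v hv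
    rw [hfn, Set.mem_ofPred_eq, ← ha, Units.smul_def, map_smul, smul_eq_mul]
    simp

theorem IsProjLine.exists_dual {L : Set ProjPlane} (h : IsProjLine L) :
    ∃ l : ProjPlane, ∀ p, p ∈ L ↔ Projectivization.orthogonal l p := by
  obtain ⟨n, hn, H⟩ := h.exists_normal
  refine ⟨Projectivization.mk ℂ n hn, fun p => ?_⟩
  induction p using Projectivization.ind with | h v hv => rw [H, Projectivization.orthogonal_mk]

theorem IsProjLine.point_unique {L K : Set ProjPlane} (hL : IsProjLine L) (hK : IsProjLine K)
    (hne : L ≠ K) {p q : ProjPlane} (hpL : p ∈ L) (hpK : p ∈ K) (hqL : q ∈ L) (hqK : q ∈ K) :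
    p = q := by
  obtain ⟨l, hl⟩ := hL.exists_dual
  obtain ⟨k, hk⟩ := hK.exists_dual
  rcases Configuration.ofField.eq_or_eq_of_orthogonal ((hl p).1 hpL) ((hk p).1 hpK)
    ((hl q).1 hqL) ((hk q).1 hqK) with h | h
  · subst h
    exact absurd (Set.ext fun p => (hl p).trans (hk p).symm) hne
  · exact h

/-- The normal vector of a projective line (zero for other sets). -/
def normalVec (L : Set ProjPlane) : Fin 3 → ℂ :=
  if h : IsProjLine L then h.exists_normal.choose else 0

theorem IsProjLine.normalVec_ne_zero {L : Set ProjPlane} (h : IsProjLine L) :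
    normalVec L ≠ 0 := by
  rw [normalVec, dif_pos h]
  exact h.exists_normal.choose_spec.1

theorem IsProjLine.mk_mem_iff {L : Set ProjPlane} (h : IsProjLine L) (v : Fin 3 → ℂ)
    (hv : v ≠ 0) : Projectivization.mk ℂ v hv ∈ L ↔ normalVec L ⬝ᵥ v = 0 := by
  rw [normalVec, dif_pos h]
  exact h.exists_normal.choose_spec.2 v hv

theorem bracket_normalVec_eq_zero_iff {L₁ L₂ L₃ : Set ProjPlane} (h₁ : IsProjLine L₁)
    (h₂ : IsProjLine L₂) (h₃ : IsProjLine L₃) :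
    bracket (normalVec L₁) (normalVec L₂) (normalVec L₃) = 0 ↔ ∃ p, p ∈ L₁ ∧ p ∈ L₂ ∧ p ∈ L₃ := by
  rw [bracket_eq_zero_iff]
  constructor
  · rintro ⟨v, hv, H⟩
    exact ⟨.mk ℂ v hv, by rwa [h₁.mk_mem_iff, h₂.mk_mem_iff, h₃.mk_mem_iff]⟩
  · rintro ⟨p, H⟩
    induction p using Projectivization.ind with | h v hv =>
    exact ⟨v, hv, by rwa [h₁.mk_mem_iff, h₂.mk_mem_iff, h₃.mk_mem_iff] at H⟩

theorem IsProjLine.exists_common_point {L K : Set ProjPlane} (hL : IsProjLine L)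
    (hK : IsProjLine K) : ∃ p, p ∈ L ∧ p ∈ K := by
  obtain ⟨p, hp⟩ := (bracket_normalVec_eq_zero_iff hL hK hK).1 (by rw [bracket_eq]; ring)
  exact ⟨p, hp.1, hp.2.1⟩

/-- Two disjoint finite families of pairwise meeting lines such that every point lying on lines of
both families lies on exactly two lines of each. -/
structure IsBicolored {P : Type*} (R B : Finset (Set P)) : Prop where
  disj : Disjoint R B
  meet : ∀ L ∈ R ∪ B, ∀ K ∈ R ∪ B, ∃ p, p ∈ L ∧ p ∈ K
  uniq : ∀ L ∈ R ∪ B, ∀ K ∈ R ∪ B, L ≠ K → ∀ p q, p ∈ L → p ∈ K → q ∈ L → q ∈ K → p = q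
  left_card : ∀ L ∈ R, ∀ K ∈ B, ∀ p, p ∈ L → p ∈ K → (R.filter (p ∈ ·)).card = 2
  right_card : ∀ L ∈ R, ∀ K ∈ B, ∀ p, p ∈ L → p ∈ K → (B.filter (p ∈ ·)).card = 2

/-- Two lines meet at a point lying on a line of the family `B`. -/
def MixedPair {P : Type*} (B : Finset (Set P)) (L L' : Set P) : Prop :=
  ∃ K ∈ B, ∃ p, p ∈ K ∧ p ∈ L ∧ p ∈ L'

theorem MixedPair.symm {P : Type*} {B : Finset (Set P)} {L L' : Set P} (h : MixedPair B L L') :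
    MixedPair B L' L := by
  obtain ⟨K, hK, p, h₁, h₂, h₃⟩ := h
  exact ⟨K, hK, p, h₁, h₃, h₂⟩

namespace IsBicolored

variable {P : Type*} {R B : Finset (Set P)}

theorem symm (h : IsBicolored R B) : IsBicolored B R where
  disj := h.disj.symm
  meet := by rw [Finset.union_comm]; exact h.meet
  uniq := by rw [Finset.union_comm]; exact h.uniq
  left_card := fun L hL K hK p hp hp' => h.right_card K hK L hL p hp' hp
  right_card := fun L hL K hK p hp hp' => h.left_card K hK L hL p hp' hp

theorem ne (h : IsBicolored R B) {L K : Set P} (hL : L ∈ R) (hK : K ∈ B) : L ≠ K := by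
  rintro rfl
  exact Finset.disjoint_left.1 h.disj hL hK

theorem uniq_left (h : IsBicolored R B) {L L' : Set P} (hL : L ∈ R) (hL' : L' ∈ R) (hne : L ≠ L')
    {p q : P} (hp : p ∈ L) (hp' : p ∈ L') (hq : q ∈ L) (hq' : q ∈ L') : p = q :=
  h.uniq L (Finset.mem_union_left _ hL) L' (Finset.mem_union_left _ hL') hne p q hp hp' hq hq'

theorem uniq_mixed (h : IsBicolored R B) {L K : Set P} (hL : L ∈ R) (hK : K ∈ B)
    {p q : P} (hp : p ∈ L) (hp' : p ∈ K) (hq : q ∈ L) (hq' : q ∈ K) : p = q :=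
  h.uniq L (Finset.mem_union_left _ hL) K (Finset.mem_union_right _ hK) (h.ne hL hK)
    p q hp hp' hq hq'

theorem card_eq (h : IsBicolored R B) {L : Set P} (hL : L ∈ R) :
    B.card = 2 * ((R.erase L).filter (MixedPair B L)).card := by
  have := Finset.card_mul_eq_card_mul (s := B) (t := (R.erase L).filter (MixedPair B L))
    (fun K L' => ∃ p, p ∈ K ∧ p ∈ L ∧ p ∈ L') (m := 1) (n := 2) ?_ ?_
  · omega
  · intro K hK
    obtain ⟨p, hpL, hpK⟩ := h.meet L (Finset.mem_union_left _ hL) K (Finset.mem_union_right _ hK)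
    have hc := h.left_card L hL K hK p hpL hpK
    have hmem : L ∈ R.filter (p ∈ ·) := Finset.mem_filter.2 ⟨hL, hpL⟩
    have : Finset.bipartiteAbove (fun K L' => ∃ p, p ∈ K ∧ p ∈ L ∧ p ∈ L')
        ((R.erase L).filter (MixedPair B L)) K = (R.filter (p ∈ ·)).erase L := by
      ext L'
      simp only [Finset.mem_bipartiteAbove, Finset.mem_filter, Finset.mem_erase]
      constructor
      · rintro ⟨⟨⟨hne, hR⟩, -⟩, q, hqK, hqL, hqL'⟩
        obtain rfl := h.uniq_mixed hL hK hqL hqK hpL hpK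
        exact ⟨hne, hR, hqL'⟩
      · rintro ⟨hne, hR, hp⟩
        exact ⟨⟨⟨hne, hR⟩, K, hK, p, hpK, hpL, hp⟩, p, hpK, hpL, hp⟩
    rw [this, Finset.card_erase_of_mem hmem, hc]
  · intro L' hL'
    simp only [Finset.mem_filter, Finset.mem_erase] at hL'
    obtain ⟨⟨hne, hR⟩, K, hK, p, hpK, hpL, hpL'⟩ := hL'
    rw [← h.right_card L hL K hK p hpL hpK]
    congr 1
    ext K'
    simp only [Finset.mem_bipartiteBelow, Finset.mem_filter]
    refine and_congr_right fun hK' => ⟨?_, fun hp => ⟨p, hp, hpL, hpL'⟩⟩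
    rintro ⟨q, hqK, hqL, hqL'⟩
    rwa [← h.uniq_left hL hR hne.symm hqL hqL' hpL hpL']

theorem card_cases (h : IsBicolored R B) (hR : R.Nonempty) (hB : B.Nonempty)
    (hcard : R.card + B.card = 14) :
    (R.card = 6 ∧ B.card = 8) ∨ (B.card = 6 ∧ R.card = 8) := by
  obtain ⟨L, hL⟩ := hR
  obtain ⟨K, hK⟩ := hB
  have h₁ := h.card_eq hL
  have h₂ := h.symm.card_eq hK
  have h₃ := Finset.card_filter_le (R.erase L) (MixedPair B L)
  have h₄ := Finset.card_filter_le (B.erase K) (MixedPair R K)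
  rw [Finset.card_erase_of_mem hL] at h₃
  rw [Finset.card_erase_of_mem hK] at h₄
  omega

theorem existsUnique_mate (h : IsBicolored R B) (hR : R.card = 6) (hB : B.card = 8) {L : Set P}
    (hL : L ∈ R) : ∃ M ∈ R, M ≠ L ∧ ¬ MixedPair B L M ∧
      ∀ M' ∈ R, M' ≠ L → ¬ MixedPair B L M' → M' = M := by
  have h₁ := h.card_eq hL
  have h₂ := Finset.card_filter_add_card_filter_not (s := R.erase L) (MixedPair B L)
  rw [Finset.card_erase_of_mem hL] at h₂
  obtain ⟨M, hM⟩ := Finset.card_eq_one.1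
    (show ((R.erase L).filter (¬ MixedPair B L ·)).card = 1 by omega)
  have hM' := Finset.ext_iff.1 hM
  simp only [Finset.mem_filter, Finset.mem_erase, Finset.mem_singleton] at hM'
  obtain ⟨⟨h₃, h₄⟩, h₅⟩ := (hM' M).2 rfl
  exact ⟨M, h₄, h₃, h₅, fun M' a b c => (hM' M').1 ⟨⟨b, a⟩, c⟩⟩

theorem not_three (h : IsBicolored R B) {K u v w : Set P} (hK : K ∈ B) (hu : u ∈ R) (hv : v ∈ R)
    (hw : w ∈ R) (huv : u ≠ v) (huw : u ≠ w) (hvw : v ≠ w) {p : P} (hpK : p ∈ K) (hpu : p ∈ u)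
    (hpv : p ∈ v) (hpw : p ∈ w) : False := by
  have := h.left_card u hu K hK p hpu hpK
  have h₃ : 2 < (R.filter (p ∈ ·)).card :=
    Finset.two_lt_card.2 ⟨u, by simp [*], v, by simp [*], w, by simp [*], huv, huw, hvw⟩
  omega

/-- On a line of `B`, every line of `R` is met at the same point as a second line of `R`. -/
theorem exists_partner (h : IsBicolored R B) {K u : Set P} (hK : K ∈ B) (hu : u ∈ R) :
    ∃ v ∈ R, v ≠ u ∧ ∃ p, p ∈ K ∧ p ∈ u ∧ p ∈ v := by
  obtain ⟨p, hpu, hpK⟩ := h.meet u (Finset.mem_union_left _ hu) K (Finset.mem_union_right _ hK)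
  obtain ⟨v, hv, hne⟩ := Finset.exists_mem_ne
    (show 1 < (R.filter (p ∈ ·)).card by rw [h.left_card u hu K hK p hpu hpK]; omega) u
  rw [Finset.mem_filter] at hv
  exact ⟨v, hv.1, hne, p, hpK, hpu, hv.2⟩

theorem partner_unique (h : IsBicolored R B) {K u v w : Set P} (hK : K ∈ B) (hu : u ∈ R)
    (hv : v ∈ R) (hw : w ∈ R) (huv : u ≠ v) (huw : u ≠ w) (h₁ : ∃ p, p ∈ K ∧ p ∈ u ∧ p ∈ v)
    (h₂ : ∃ p, p ∈ K ∧ p ∈ u ∧ p ∈ w) : v = w := by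
  obtain ⟨p, hpK, hpu, hpv⟩ := h₁
  obtain ⟨q, hqK, hqu, hqw⟩ := h₂
  obtain rfl := h.uniq_mixed hu hK hpu hpK hqu hqK
  by_contra hvw
  exact h.not_three hK hu hv hw huv huw hvw hpK hpu hpv hqw

end IsBicolored

/-- Six lines `x, x', a, a', b, b'` exhausting `R`, where `{x, x'}`, `{a, a'}` and `{b, b'}` are
the pairs that are not mixed. -/
structure IsOctahedron {P : Type*} (R B : Finset (Set P)) (x x' a a' b b' : Set P) : Prop where
  nodup : [x, x', a, a', b, b'].Nodup
  mem_iff : ∀ L, L ∈ R ↔ L = x ∨ L = x' ∨ L = a ∨ L = a' ∨ L = b ∨ L = b'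
  not_x : ¬ MixedPair B x x'
  not_a : ¬ MixedPair B a a'
  not_b : ¬ MixedPair B b b'

namespace IsBicolored

variable {P : Type*} {R B : Finset (Set P)}

theorem exists_octahedron (h : IsBicolored R B) (hR : R.card = 6) (hB : B.card = 8) :
    ∃ x x' a a' b b', IsOctahedron R B x x' a a' b b' := by
  choose! m hm hne hmix huniq using fun L (hL : L ∈ R) => h.existsUnique_mate hR hB hL
  have hinv : ∀ L ∈ R, m (m L) = L := fun L hL =>
    (huniq (m L) (hm L hL) L hL (hne L hL).symm fun H => hmix L hL H.symm).symm
  have pick : ∀ S : Finset (Set P), S.card < 6 → ∃ L ∈ R, L ∉ S := fun S hS =>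
    Finset.exists_mem_notMem_of_card_lt_card (hR ▸ hS)
  obtain ⟨x, hx, -⟩ := pick ∅ (by simp)
  obtain ⟨a, ha, haS⟩ := pick {x, m x} ((Finset.card_le_two).trans_lt (by norm_num))
  obtain ⟨b, hb, hbS⟩ := pick {x, m x, a, m a} ((Finset.card_le_four).trans_lt (by norm_num))
  simp only [Finset.mem_insert, Finset.mem_singleton, not_or] at haS hbS
  have nd : [x, m x, a, m a, b, m b].Nodup := by
    have i₁ := hinv x hx
    have i₂ := hinv a ha
    have i₃ := hinv b hb
    have n₁ := hne x hx
    have n₂ := hne a ha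
    have n₃ := hne b hb
    simp only [List.nodup_cons, List.mem_cons, List.not_mem_nil, not_or, or_false]
    grind
  refine ⟨x, m x, a, m a, b, m b, nd, ?_, hmix x hx, hmix a ha, hmix b hb⟩
  have hsub : [x, m x, a, m a, b, m b].toFinset ⊆ R := by
    intro L hL
    simp only [List.mem_toFinset, List.mem_cons, List.not_mem_nil, or_false] at hL
    rcases hL with rfl | rfl | rfl | rfl | rfl | rfl <;> simp [*]
  have heq := Finset.eq_of_subset_of_card_le hsub (by
    rw [List.toFinset_card_of_nodup nd, hR]; rfl)
  intro L
  rw [← heq]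
  simp

/-- A pairing on `{x, x', a, a', b, b'}` that avoids the pairs `xx'`, `aa'`, `bb'` and contains `xa`
contains `x'b` and `a'b'`, or `x'b'`. -/
theorem matching_cases {α : Type*} {R : Finset α} {Q : α → α → Prop} {x x' a a' b b' : α}
    (nd : [x, x', a, a', b, b'].Nodup) (mem : ∀ u, u ∈ R ↔ u ∈ [x, x', a, a', b, b'])
    (sy : ∀ u v, Q u v → Q v u)
    (un : ∀ u ∈ R, ∀ v ∈ R, ∀ w ∈ R, u ≠ v → u ≠ w → Q u v → Q u w → v = w)
    (nx : ¬ Q x x') (na : ¬ Q a a') (nb : ¬ Q b b')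
    (ex : ∀ u ∈ R, ∃ v ∈ R, v ≠ u ∧ Q u v) (hxa : Q x a) : (Q x' b ∧ Q a' b') ∨ Q x' b' := by
  have hx : x ∈ R := by simp [mem]
  have hx' : x' ∈ R := by simp [mem]
  have ha : a ∈ R := by simp [mem]
  have ha' : a' ∈ R := by simp [mem]
  have hb : b ∈ R := by simp [mem]
  have hb' : b' ∈ R := by simp [mem]
  obtain ⟨v, hv, hvne, hP⟩ := ex x' hx'
  obtain ⟨w, hw, hwne, hQ⟩ := ex a' ha'
  obtain ⟨z, hz, hzne, hS⟩ := ex b hb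
  clear ex
  simp only [mem, List.mem_cons, List.not_mem_nil, or_false] at hv hw hz
  simp only [List.nodup_cons, List.mem_cons, List.not_mem_nil, not_or, or_false] at nd
  clear mem
  rcases hv with rfl | rfl | rfl | rfl | rfl | rfl
  · exact (nx (sy _ _ hP)).elim
  · exact (hvne rfl).elim
  · grind
  · rcases hz with rfl | rfl | rfl | rfl | rfl | rfl <;> grind
  · rcases hw with rfl | rfl | rfl | rfl | rfl | rfl <;> grind
  · exact Or.inr hP

theorem three_not_concurrent (h : IsBicolored R B) (hR : R.card = 6) (hB : B.card = 8)
    {u v w : Set P} (hu : u ∈ R) (hv : v ∈ R) (hw : w ∈ R) (huv : u ≠ v) (huw : u ≠ w)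
    (hvw : v ≠ w) : ¬ ∃ p, p ∈ u ∧ p ∈ v ∧ p ∈ w := by
  rintro ⟨p, hpu, hpv, hpw⟩
  obtain ⟨m, -, -, -, hm⟩ := h.existsUnique_mate hR hB hu
  have key : MixedPair B u v ∨ MixedPair B u w := by
    by_contra! H
    exact hvw ((hm v hv huv.symm H.1).trans (hm w hw huw.symm H.2).symm)
  rcases key with ⟨K, hK, q, hqK, hqu, hq⟩ | ⟨K, hK, q, hqK, hqu, hq⟩
  · obtain rfl := h.uniq_left hu hv huv hqu hq hpu hpv
    exact h.not_three hK hu hv hw huv huw hvw hqK hpu hpv hpw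
  · obtain rfl := h.uniq_left hu hw huw hqu hq hpu hpw
    exact h.not_three hK hu hv hw huv huw hvw hqK hpu hpv hpw

theorem exists_matching_line (h : IsBicolored R B) (hR : R.card = 6) (hB : B.card = 8)
    {x x' a a' b b' : Set P} (o : IsOctahedron R B x x' a a' b b') :
    ∃ K ∈ B, (∃ p, p ∈ K ∧ p ∈ x ∧ p ∈ a) ∧ (∃ p, p ∈ K ∧ p ∈ x' ∧ p ∈ b) ∧
      ∃ p, p ∈ K ∧ p ∈ a' ∧ p ∈ b' := by
  have nd := o.nodup
  have hx : x ∈ R := by simp [o.mem_iff]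
  have hx' : x' ∈ R := by simp [o.mem_iff]
  have ha : a ∈ R := by simp [o.mem_iff]
  have ha' : a' ∈ R := by simp [o.mem_iff]
  have hb : b ∈ R := by simp [o.mem_iff]
  have hb' : b' ∈ R := by simp [o.mem_iff]
  simp only [List.nodup_cons, List.mem_cons, List.not_mem_nil, not_or, or_false] at nd
  have claim : ∀ K ∈ B, (∃ p, p ∈ K ∧ p ∈ x ∧ p ∈ a) →
      ((∃ p, p ∈ K ∧ p ∈ x' ∧ p ∈ b) ∧ ∃ p, p ∈ K ∧ p ∈ a' ∧ p ∈ b') ∨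
      (∃ p, p ∈ K ∧ p ∈ x' ∧ p ∈ b') := by
    intro K hK hxa
    set Pr : Set P → Set P → Prop := fun u v => ∃ p, p ∈ K ∧ p ∈ u ∧ p ∈ v with hPr
    have sy : ∀ u v, Pr u v → Pr v u := fun u v ⟨p, h₁, h₂, h₃⟩ => ⟨p, h₁, h₃, h₂⟩
    have un : ∀ u ∈ R, ∀ v ∈ R, ∀ w ∈ R, u ≠ v → u ≠ w → Pr u v → Pr u w → v = w :=
      fun u hu v hv w hw h₁ h₂ h₃ h₄ => h.partner_unique hK hu hv hw h₁ h₂ h₃ h₄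
    have nx : ¬ Pr x x' := fun H => o.not_x ⟨K, hK, H⟩
    have na : ¬ Pr a a' := fun H => o.not_a ⟨K, hK, H⟩
    have nb : ¬ Pr b b' := fun H => o.not_b ⟨K, hK, H⟩
    exact matching_cases o.nodup (by simpa using o.mem_iff) sy un nx na nb
      (fun u hu => h.exists_partner hK hu) hxa
  obtain ⟨p, K, K', hKK', hK, hK', hpK, hpK', hpx, hpa⟩ : ∃ p K K', K ≠ K' ∧ K ∈ B ∧ K' ∈ B ∧
      p ∈ K ∧ p ∈ K' ∧ p ∈ x ∧ p ∈ a := by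
    have hm : MixedPair B x a := by
      obtain ⟨m, -, -, -, hm⟩ := h.existsUnique_mate hR hB hx
      by_contra H
      exact nd.2.1.1 ((hm x' hx' (Ne.symm nd.1.1) o.not_x).trans
        (hm a ha (Ne.symm nd.1.2.1) H).symm)
    obtain ⟨K, hK, p, hpK, hpx, hpa⟩ := hm
    obtain ⟨K', hK', hne⟩ := Finset.exists_mem_ne
      (show 1 < (B.filter (p ∈ ·)).card by rw [h.right_card x hx K hK p hpx hpK]; omega) K
    rw [Finset.mem_filter] at hK'
    exact ⟨p, K, K', hne.symm, hK, hK'.1, hpK, hK'.2, hpx, hpa⟩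
  rcases claim K hK ⟨p, hpK, hpx, hpa⟩ with H | ⟨q, hqK, hqx, hqb⟩
  · exact ⟨K, hK, ⟨p, hpK, hpx, hpa⟩, H⟩
  rcases claim K' hK' ⟨p, hpK', hpx, hpa⟩ with H | ⟨q', hqK', hqx', hqb'⟩
  · exact ⟨K', hK', ⟨p, hpK', hpx, hpa⟩, H⟩
  obtain rfl := h.uniq_left hx' hb' nd.2.1.2.2.2 hqx hqb hqx' hqb'
  obtain rfl := h.symm.uniq_left hK hK' hKK' hpK hpK' hqK hqK'
  exact (h.not_three hK hx ha hx' nd.1.2.1 nd.1.1 (Ne.symm nd.2.1.1) hpK hpx hpa hqx).elim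

end IsBicolored

namespace IsOctahedron

variable {P : Type*} {R B : Finset (Set P)} {x x' a a' b b' : Set P}

theorem swap_x (o : IsOctahedron R B x x' a a' b b') : IsOctahedron R B x' x a a' b b' where
  nodup := (List.Perm.swap x' x _).nodup_iff.1 o.nodup
  mem_iff L := by rw [o.mem_iff]; tauto
  not_x H := o.not_x H.symm
  not_a := o.not_a
  not_b := o.not_b

theorem swap_b (o : IsOctahedron R B x x' a a' b b') : IsOctahedron R B x x' a a' b' b where
  nodup := by
    have := o.nodup
    grind
  mem_iff L := by rw [o.mem_iff]; tauto
  not_x := o.not_x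
  not_a := o.not_a
  not_b H := o.not_b H.symm

theorem swap_a (o : IsOctahedron R B x x' a a' b b') : IsOctahedron R B x x' a' a b b' where
  nodup := by
    have := o.nodup
    grind
  mem_iff L := by rw [o.mem_iff]; tauto
  not_x := o.not_x
  not_a H := o.not_a H.symm
  not_b := o.not_b

end IsOctahedron

theorem IsBicolored.not_six_eight {R B : Finset (Set ProjPlane)} (h : IsBicolored R B)
    (hlR : ∀ L ∈ R, IsProjLine L) (hlB : ∀ L ∈ B, IsProjLine L) (hR : R.card = 6)
    (hB : B.card = 8) : False := by
  obtain ⟨l₁, l₂, l₃, l₄, l₅, l₆, o⟩ := h.exists_octahedron hR hB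
  have nd := o.nodup
  have m₁ : l₁ ∈ R := by simp [o.mem_iff]
  have m₂ : l₂ ∈ R := by simp [o.mem_iff]
  have m₃ : l₃ ∈ R := by simp [o.mem_iff]
  have m₄ : l₄ ∈ R := by simp [o.mem_iff]
  have m₅ : l₅ ∈ R := by simp [o.mem_iff]
  have m₆ : l₆ ∈ R := by simp [o.mem_iff]
  have nondeg {u v w : Set ProjPlane} (hu : u ∈ R) (hv : v ∈ R) (hw : w ∈ R) (huv : u ≠ v)
      (huw : u ≠ w) (hvw : v ≠ w) : bracket (normalVec u) (normalVec v) (normalVec w) ≠ 0 := by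
    rw [Ne, bracket_normalVec_eq_zero_iff (hlR u hu) (hlR v hv) (hlR w hw)]
    exact h.three_not_concurrent hR hB hu hv hw huv huw hvw
  have rel {x x' a a' b b' : Set ProjPlane} (o : IsOctahedron R B x x' a a' b b') :
      bracket (normalVec x) (normalVec x') (normalVec b)
          * bracket (normalVec a) (normalVec a') (normalVec b')
        = bracket (normalVec a) (normalVec x') (normalVec b)
          * bracket (normalVec x) (normalVec a') (normalVec b') := by
    obtain ⟨K, hK, h₁, h₂, h₃⟩ := h.exists_matching_line hR hB o
    have l {y : Set ProjPlane} (hy : y = x ∨ y = x' ∨ y = a ∨ y = a' ∨ y = b ∨ y = b') :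
        IsProjLine y := hlR y ((o.mem_iff y).2 hy)
    refine bracket_relation (hlB K hK).normalVec_ne_zero ?_ ?_ ?_
    · rwa [bracket_normalVec_eq_zero_iff (hlB K hK) (l (by simp)) (l (by simp))]
    · rwa [bracket_normalVec_eq_zero_iff (hlB K hK) (l (by simp)) (l (by simp))]
    · rwa [bracket_normalVec_eq_zero_iff (hlB K hK) (l (by simp)) (l (by simp))]
  simp only [List.nodup_cons, List.mem_cons, List.not_mem_nil, not_or, or_false] at nd
  exact bracket_degenerate (nondeg m₁ m₂ m₃ (by tauto) (by tauto) (by tauto))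
    (nondeg m₁ m₂ m₆ (by tauto) (by tauto) (by tauto))
    (nondeg m₃ m₄ m₅ (by tauto) (by tauto) (by tauto))
    (rel o) (rel o.swap_a) (rel o.swap_a.swap_b) (rel o.swap_a.swap_x) (rel o.swap_a.swap_x.swap_b)

/-- The two level sets of a 2-cocycle form a bicolored pair when all multiplicities are at
most 5. -/
theorem IsCocycle.isBicolored {A : Finset (Set ProjPlane)} (hlines : ∀ L ∈ A, IsProjLine L)
    (hmult : ∀ p : ProjPlane, IsMultPoint A p → mult A p ≤ 5) {η : Set ProjPlane → ZMod 2}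
    (hη : IsCocycle 2 A η) : IsBicolored (A.filter (η · = 1)) (A.filter (¬ η · = 1)) := by
  have hU : A.filter (η · = 1) ∪ A.filter (¬ η · = 1) = A := Finset.filter_union_filter_not_eq _ A
  have key : ∀ L ∈ A.filter (η · = 1), ∀ K ∈ A.filter (¬ η · = 1), ∀ p, p ∈ L → p ∈ K →
      ((A.filter (η · = 1)).filter (p ∈ ·)).card = 2 ∧
      ((A.filter (¬ η · = 1)).filter (p ∈ ·)).card = 2 := by
    intro L hL K hK p hpL hpK
    have c₁ : 0 < ((A.filter (η · = 1)).filter (p ∈ ·)).card :=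
      Finset.card_pos.2 ⟨L, Finset.mem_filter.2 ⟨hL, hpL⟩⟩
    have c₂ : 0 < ((A.filter (¬ η · = 1)).filter (p ∈ ·)).card :=
      Finset.card_pos.2 ⟨K, Finset.mem_filter.2 ⟨hK, hpK⟩⟩
    have c : ((A.filter (η · = 1)).filter (p ∈ ·)).card
        + ((A.filter (¬ η · = 1)).filter (p ∈ ·)).card = mult A p := by
      rw [Finset.filter_comm, Finset.filter_comm (s := A) (p := (¬ η · = 1)), mult, linesThrough]
      exact Finset.card_filter_add_card_filter_not _
    have hm : IsMultPoint A p := by rw [IsMultPoint]; omega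
    have h5 := hmult p hm
    obtain ⟨hev, hodd⟩ := hη p hm
    rw [Finset.mem_filter] at hL hK
    have h2 : 2 ∣ mult A p := by
      by_contra h2
      have := hodd h2 L (Finset.mem_filter.2 ⟨hL.1, hpL⟩) K (Finset.mem_filter.2 ⟨hK.1, hpK⟩)
      exact hK.2 (this ▸ hL.2)
    have hsum := hev h2
    have hsum' : ∑ M ∈ linesThrough A p, η M
        = (((A.filter (η · = 1)).filter (p ∈ ·)).card : ZMod 2) := by
      rw [Finset.filter_comm, ← Finset.sum_boole]
      refine Finset.sum_congr rfl fun M _ => ?_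
      generalize η M = t
      revert t
      decide
    rw [hsum', ZMod.natCast_eq_zero_iff] at hsum
    omega
  refine ⟨Finset.disjoint_filter_filter_not A A _, ?_, ?_, fun L hL K hK p h h' =>
    (key L hL K hK p h h').1, fun L hL K hK p h h' => (key L hL K hK p h h').2⟩
  · rw [hU]
    exact fun L hL K hK => (hlines L hL).exists_common_point (hlines K hK)
  · rw [hU]
    exact fun L hL K hK hne p q h₁ h₂ h₃ h₄ =>
      (hlines L hL).point_unique (hlines K hK) hne h₁ h₂ h₃ h₄

/-- an arrangement of 14 lines with points of multiplicity at most 5 admits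
no non-constant 2-cocycle. -/
theorem statement18 (A : Finset (Set ProjPlane))
    (hlines : ∀ L ∈ A, IsProjLine L) (hcard : A.card = 14)
    (hmult : ∀ p : ProjPlane, IsMultPoint A p → mult A p ≤ 5) :
    ¬ ∃ η : Set ProjPlane → ZMod 2, IsCocycle 2 A η ∧ NonConstant A η := by
  rintro ⟨η, hη, L, hL, K, hK, hne⟩
  have h := hη.isBicolored hlines hmult
  have hR : (A.filter (η · = 1)).Nonempty := by
    by_contra! H
    rw [Finset.filter_eq_empty_iff] at H
    have h₁ := H hL
    have h₂ := H hK
    revert hne h₁ h₂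
    generalize η L = s, η K = t
    revert s t
    decide
  have hB : (A.filter (¬ η · = 1)).Nonempty := by
    by_contra! H
    rw [Finset.filter_eq_empty_iff] at H
    exact hne ((not_not.1 (H hL)).trans (not_not.1 (H hK)).symm)
  have hc : (A.filter (η · = 1)).card + (A.filter (¬ η · = 1)).card = 14 := by
    rw [Finset.card_filter_add_card_filter_not, hcard]
  have hlR : ∀ L ∈ A.filter (η · = 1), IsProjLine L := fun L hL =>
    hlines L (Finset.mem_filter.1 hL).1
  have hlB : ∀ L ∈ A.filter (¬ η · = 1), IsProjLine L := fun L hL =>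
    hlines L (Finset.mem_filter.1 hL).1
  rcases h.card_cases hR hB hc with ⟨h₁, h₂⟩ | ⟨h₁, h₂⟩
  · exact h.not_six_eight hlR hlB h₁ h₂
  · exact h.symm.not_six_eight hlB hlR h₁ h₂
end
end
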